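/- Let I be a set and for each i ∈ I let θ_i ∈ ℝ, and suppose the real numbers 1 and θ_i for i ∈ I are linearly independent over ℚ. For each i ∈ I let X_i be a compact Hausdorff space, let k_i : X_i → X_i be a homeomorphism, let g_i : X_i → ℝ/ℤ be a continuous surjection satisfying g_i(k_i(x)) = g_i(x) + θ_i (mod 1) for all x ∈ X_i, and suppose there is a dense subset R_i ⊆ X_i such that g_i is strictly open at every point of R_i. Then the product homeomorphism k : ∏_{i ∈ I} X_i → ∏_{i ∈ I} X_i acting as k_i in the i-th coordinate is minimal. (For restricted Denjoy homeomorphisms with rotation numbers θ_i, such maps g_i and sets R_i always exist, so products of restricted Denjoy homeomorphisms with rotation numbers rationally independent together with 1 are minimal.) -/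

import Mathlib

/-- `g` is strictly open at `y` if the preimages `g ⁻¹' U` of open sets `U ∋ g y` form a
neighborhood base at `y`. -/
def StrictlyOpenAt {Y X : Type*} [TopologicalSpace Y] [TopologicalSpace X]
    (g : Y → X) (y : Y) : Prop :=
  (nhds y).HasBasis (fun U : Set X => IsOpen U ∧ g y ∈ U) (fun U => g ⁻¹' U)

open Filter Topology UnitAddTorus

/-- The average of `f` over the first `N` points of the orbit of `x` under translation by `t`. -/
noncomputable def translationAverage {G : Type*} [AddMonoid G] (t : G) (f : G → ℂ) (N : ℕ)
    (x : G) : ℂ :=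
  (N : ℂ)⁻¹ * ∑ n ∈ Finset.range N, f (x + n • t)

lemma translationAverage_of_forall_eq {G : Type*} [AddMonoid G] {t : G} {f : G → ℂ} {x : G}
    {c : ℂ} (h : ∀ n : ℕ, f (x + n • t) = c) {N : ℕ} (hN : N ≠ 0) :
    translationAverage t f N x = c := by
  have : (N : ℂ) ≠ 0 := Nat.cast_ne_zero.2 hN
  simp [translationAverage, h, this]

lemma norm_translationAverage_sub_le {G : Type*} [AddMonoid G] {t : G} {f g : G → ℂ} {ε : ℝ}
    (h : ∀ x, ‖f x - g x‖ ≤ ε) (hε : 0 ≤ ε) (N : ℕ) (x : G) :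
    ‖translationAverage t f N x - translationAverage t g N x‖ ≤ ε := by
  rw [translationAverage, translationAverage, ← mul_sub, ← Finset.sum_sub_distrib, norm_mul]
  have h₁ : ‖∑ n ∈ Finset.range N, (f (x + n • t) - g (x + n • t))‖ ≤ N * ε := by
    simpa using norm_sum_le_of_le (Finset.range N) (fun n _ => h (x + n • t))
  rcases Nat.eq_zero_or_pos N with rfl | hN
  · simpa using hε
  have hN' : (0 : ℝ) < N := Nat.cast_pos.2 hN
  rw [norm_inv, Complex.norm_natCast, inv_mul_le_iff₀ hN']
  exact h₁

lemma tendsto_inv_mul_geom_sum {z : ℂ} (hz : ‖z‖ = 1) (hz1 : z ≠ 1) :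
    Tendsto (fun N : ℕ => (N : ℂ)⁻¹ * ∑ n ∈ Finset.range N, z ^ n) atTop (𝓝 0) := by
  refine squeeze_zero_norm (a := fun N : ℕ => (N : ℝ)⁻¹ * (2 / ‖z - 1‖)) (fun N => ?_) ?_
  · rw [norm_mul, norm_inv, Complex.norm_natCast, geom_sum_eq hz1, norm_div]
    gcongr
    calc ‖z ^ N - 1‖ ≤ ‖z ^ N‖ + ‖(1 : ℂ)‖ := norm_sub_le _ _
      _ = 2 := by rw [norm_pow, hz]; norm_num
  · simpa using (tendsto_inv_atTop_nhds_zero_nat (𝕜 := ℝ)).mul_const (2 / ‖z - 1‖)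

namespace UnitAddTorus

variable {d : Type*} [Fintype d]

lemma mFourier_apply_add (m : d → ℤ) (x y : UnitAddTorus d) :
    mFourier m (x + y) = mFourier m x * mFourier m y := by
  simp [mFourier, fourier_apply, smul_add, AddCircle.toCircle_add, Finset.prod_mul_distrib]

lemma mFourier_apply_nsmul (m : d → ℤ) (n : ℕ) (x : UnitAddTorus d) :
    mFourier m (n • x) = mFourier m x ^ n := by
  induction n with
  | zero => simp [mFourier]
  | succ n ih => rw [succ_nsmul, mFourier_apply_add, ih, pow_succ]

lemma norm_mFourier_apply (m : d → ℤ) (x : UnitAddTorus d) : ‖mFourier m x‖ = 1 := by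
  simp only [mFourier, ContinuousMap.coe_mk, fourier_apply, norm_prod, Circle.norm_coe,
    Finset.prod_const_one]

lemma mFourier_coe_apply (m : d → ℤ) (θ : d → ℝ) :
    mFourier m (fun i => (θ i : UnitAddCircle)) =
      Complex.exp (2 * Real.pi * Complex.I * ((∑ i, m i * θ i : ℝ) : ℂ)) := by
  simp only [mFourier, ContinuousMap.coe_mk, fourier_coe_apply, ← Complex.exp_sum]
  push_cast
  rw [Finset.mul_sum]
  congr 1
  refine Finset.sum_congr rfl fun i _ => ?_
  simp
  ring

lemma mFourier_coe_ne_one {θ : d → ℝ}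
    (hθ : ∀ (m : d → ℤ) (c : ℤ), ∑ i, m i * θ i = (c : ℝ) → m = 0) {m : d → ℤ} (hm : m ≠ 0) :
    mFourier m (fun i => (θ i : UnitAddCircle)) ≠ 1 := by
  rw [mFourier_coe_apply, Ne, Complex.exp_eq_one_iff]
  rintro ⟨c, hc⟩
  refine hm (hθ m c ?_)
  rw [mul_comm (c : ℂ)] at hc
  exact_mod_cast mul_left_cancel₀ Complex.two_pi_I_ne_zero hc

lemma tendsto_translationAverage_sub {t : UnitAddTorus d}
    (ht : ∀ m : d → ℤ, m ≠ 0 → mFourier m t ≠ 1) {p : C(UnitAddTorus d, ℂ)}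
    (hp : p ∈ Submodule.span ℂ (Set.range (mFourier (d := d)))) (x y : UnitAddTorus d) :
    Tendsto (fun N => translationAverage t p N x - translationAverage t p N y) atTop (𝓝 0) := by
  induction hp using Submodule.span_induction with
  | mem p hp =>
    obtain ⟨m, rfl⟩ := hp
    by_cases hm : m = 0
    · simp [hm, translationAverage, mFourier_zero]
    · have key := (tendsto_inv_mul_geom_sum (norm_mFourier_apply m t) (ht m hm)).const_mul
        (mFourier m x - mFourier m y)
      rw [mul_zero] at key
      refine key.congr fun N => ?_
      simp only [translationAverage, mFourier_apply_add, mFourier_apply_nsmul, ← Finset.mul_sum]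
      ring
  | zero => simp [translationAverage]
  | add p q _ _ hp hq =>
    rw [← add_zero (0 : ℂ)]
    refine (hp.add hq).congr fun N => ?_
    simp only [translationAverage, ContinuousMap.add_apply, Finset.sum_add_distrib]
    ring
  | smul c p _ hp =>
    rw [← mul_zero c]
    refine (hp.const_mul c).congr fun N => ?_
    simp only [translationAverage, ContinuousMap.smul_apply, smul_eq_mul, ← Finset.mul_sum]
    ring

/-- A subgroup generated by an element on which no nontrivial character is trivial is dense. -/
theorem dense_zmultiples_of_mFourier_ne_one {t : UnitAddTorus d}
    (ht : ∀ m : d → ℤ, m ≠ 0 → mFourier m t ≠ 1) :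
    Dense (AddSubgroup.zmultiples t : Set (UnitAddTorus d)) := by
  set H := (AddSubgroup.zmultiples t).topologicalClosure
  have htH : ∀ n : ℕ, n • t ∈ H := fun n =>
    H.nsmul_mem ((AddSubgroup.zmultiples t).le_topologicalClosure
      (AddSubgroup.mem_zmultiples t)) n
  have hHc : IsClosed (H : Set (UnitAddTorus d)) :=
    AddSubgroup.isClosed_topologicalClosure _
  intro v
  by_contra hv
  replace hv : v ∉ H := hv
  have hdisj : Disjoint (H : Set (UnitAddTorus d)) ((fun x => x - v) ⁻¹' H) := by
    rw [Set.disjoint_left]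
    intro x hx hxv
    exact hv (by simpa using H.sub_mem hx hxv)
  obtain ⟨f, hf0, hf1, -⟩ := exists_continuous_zero_one_of_isClosed hHc
    (hHc.preimage (continuous_id.sub continuous_const)) hdisj
  let F : C(UnitAddTorus d, ℂ) := ⟨fun x => (f x : ℂ), by fun_prop⟩
  have hF : F ∈ (Submodule.span ℂ (Set.range (mFourier (d := d)))).topologicalClosure := by
    rw [span_mFourier_closure_eq_top]; trivial
  obtain ⟨p, hp, hpF⟩ := Metric.mem_closure_iff.1 hF (1 / 4) (by norm_num)
  have hclose : ∀ x, ‖F x - p x‖ ≤ 1 / 4 := fun x => by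
    rw [← dist_eq_norm]
    exact (ContinuousMap.dist_apply_le_dist x).trans hpF.le
  obtain ⟨N, hN, hN0⟩ := (((tendsto_translationAverage_sub ht hp v 0).norm.eventually_lt_const
    (u := 1 / 4) (by norm_num)).and (eventually_ne_atTop 0)).exists
  have h0 := norm_translationAverage_sub_le (t := t) hclose (by norm_num) N 0
  have h1 := norm_translationAverage_sub_le (t := t) hclose (by norm_num) N v
  rw [translationAverage_of_forall_eq (c := 0) (fun n => ?_) hN0] at h0
  rw [translationAverage_of_forall_eq (c := 1) (fun n => ?_) hN0] at h1
  · have h2 : ‖(1 : ℂ)‖ ≤ ‖1 - translationAverage t p N v‖ +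
        ‖translationAverage t p N v - translationAverage t p N 0‖ +
        ‖0 - translationAverage t p N 0‖ := by
      rw [zero_sub, norm_neg]
      refine le_trans (le_of_eq ?_) (norm_add₃_le)
      congr 1
      ring
    rw [norm_one] at h2
    linarith
  · have : f (v + n • t) = 1 := hf1 (by simpa using htH n)
    simp [F, this]
  · have : f (0 + n • t) = 0 := hf0 (by simpa using htH n)
    simp only [F, ContinuousMap.coe_mk, this, Complex.ofReal_zero]

/-- **Kronecker's theorem**: every orbit of a rationally independent rotation is dense. -/
theorem denseRange_add_zsmul {θ : d → ℝ}
    (hθ : ∀ (m : d → ℤ) (c : ℤ), ∑ i, m i * θ i = (c : ℝ) → m = 0) (x : UnitAddTorus d) :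
    DenseRange fun n : ℤ => x + n • (fun i => (θ i : UnitAddCircle) : UnitAddTorus d) := by
  have hd : DenseRange fun n : ℤ => n • (fun i => (θ i : UnitAddCircle) : UnitAddTorus d) :=
    dense_zmultiples_of_mFourier_ne_one fun m hm => mFourier_coe_ne_one hθ hm
  exact (Homeomorph.addLeft x).surjective.denseRange.comp hd (Homeomorph.addLeft x).continuous

end UnitAddTorus

lemma LinearIndependent.eq_zero_of_sum_intCast_mul_eq {I : Type*} {θ : I → ℝ}
    (hind : LinearIndependent ℚ (fun o : Option I => o.elim 1 θ)) (s : Finset I) (m : s → ℤ)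
    (c : ℤ) (h : ∑ i, m i * θ i = (c : ℝ)) : m = 0 := by
  have hinj : Function.Injective (Option.map ((↑) : s → I)) :=
    Option.map_injective Subtype.val_injective
  have := Fintype.linearIndependent_iff.1 (hind.comp _ hinj)
    (fun o => o.elim (-c : ℚ) fun i => (m i : ℚ)) (by
      simp only [Fintype.sum_option, Rat.smul_def, Function.comp_apply, Option.map_none,
        Option.map_some, Option.elim_none, Option.elim_some, Rat.cast_neg, Rat.cast_intCast, h]
      ring)
  funext i
  simpa using this (some i)

lemma map_zpow_apply_of_map_apply_eq_add {Y A : Type*} [AddCommGroup A] (k : Equiv.Perm Y)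
    (g : Y → A) (a : A) (h : ∀ x, g (k x) = g x + a) (n : ℤ) (x : Y) :
    g ((k ^ n) x) = g x + n • a := by
  induction n with
  | zero => simp
  | succ n ih => rw [add_comm, zpow_add, zpow_one, Equiv.Perm.mul_apply, h, ih, add_zsmul,
      one_zsmul]; abel
  | pred n ih =>
    have h' : k ((k ^ (-(n : ℤ) - 1)) x) = (k ^ (-(n : ℤ))) x := by
      rw [← Equiv.Perm.mul_apply, ← zpow_one_add]; congr 2; ring
    rw [sub_zsmul, one_zsmul, ← sub_eq_add_neg, ← add_sub_assoc, ← ih, ← h', h,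
      add_sub_cancel_right]

/-- Let `(θ i)` be reals with `1` and the `θ i` linearly independent over
`ℚ`.  For each `i`, let `X i` be a compact Hausdorff space, `k i : X i ≃ₜ X i` a
homeomorphism, `g i : X i → ℝ/ℤ` a continuous surjection intertwining `k i` with the rotation
by `θ i`, which is strictly open at every point of a dense set `R i ⊆ X i`.  Then the product
homeomorphism `k` acting coordinatewise is minimal: every orbit is dense.  (In particular
products of restricted Denjoy homeomorphisms with rotation numbers rationally independent
together with `1` are minimal.) -/
theorem prod_denjoy_minimal {I : Type*} (θ : I → ℝ)
    (hind : LinearIndependent ℚ (fun o : Option I => o.elim 1 θ))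
    (X : I → Type*) [∀ i, TopologicalSpace (X i)] [∀ i, CompactSpace (X i)]
    [∀ i, T2Space (X i)]
    (k : ∀ i, X i ≃ₜ X i) (g : ∀ i, X i → AddCircle (1 : ℝ))
    (hgc : ∀ i, Continuous (g i)) (hgs : ∀ i, Function.Surjective (g i))
    (hcomm : ∀ i (x : X i), g i (k i x) = g i x + ((θ i : ℝ) : AddCircle (1 : ℝ)))
    (R : ∀ i, Set (X i)) (hR : ∀ i, Dense (R i))
    (hstr : ∀ i, ∀ x ∈ R i, StrictlyOpenAt (g i) x) :
    ∀ y : ∀ i, X i,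
      Dense (Set.range fun n : ℤ => fun i => ((k i).toEquiv ^ n) (y i)) := by
  intro y
  rw [dense_iff_inter_open]
  rintro U hU ⟨u, hu⟩
  obtain ⟨s, W, hW, hWU⟩ := isOpen_pi_iff.1 hU u hu
  have hV : ∀ i : s, ∃ V : Set (AddCircle (1 : ℝ)), IsOpen V ∧ V.Nonempty ∧ g i ⁻¹' V ⊆ W i := by
    intro i
    obtain ⟨r, hrW, hrR⟩ := (hR i).inter_open_nonempty (W i) (hW i i.2).1 ⟨u i, (hW i i.2).2⟩
    obtain ⟨V, ⟨hVo, hrV⟩, hVW⟩ :=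
      (hstr i r hrR).mem_iff.1 ((hW i i.2).1.mem_nhds hrW)
    exact ⟨V, hVo, ⟨_, hrV⟩, hVW⟩
  choose V hVo hVn hVW using hV
  obtain ⟨n, hn⟩ := (UnitAddTorus.denseRange_add_zsmul (θ := fun i : s => θ i)
    (hind.eq_zero_of_sum_intCast_mul_eq s) (fun i => g i (y i))).exists_mem_open
    (isOpen_set_pi Set.finite_univ fun i _ => hVo i) (Set.univ_pi_nonempty_iff.2 hVn)
  refine ⟨_, hWU fun i hi => hVW ⟨i, hi⟩ ?_, n, rfl⟩
  rw [Set.mem_preimage, map_zpow_apply_of_map_apply_eq_add _ _ _ (hcomm i)]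
  exact hn ⟨i, hi⟩ (Set.mem_univ _)
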